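/- Let Λ be a partially ordered set as in the context, and let σ and τ be locally finite sets of increasing tableaux of skew shapes in Λ, each closed under forward and reverse jeu de taquin slides. Then for all straight shapes λ ⊆ ν in Λ one has Σ_μ σ(ν/μ)·τ(μ/λ) = Σ_μ τ(ν/μ)·σ(μ/λ), where both sums run over all straight shapes μ with λ ⊆ μ ⊆ ν (equivalently, the operators F_σ and F_τ on Γ(Λ) commute). -/

import Mathlib

open Classical

noncomputable section

/-- A straight shape in a poset: a finite lower order ideal, given as a `Finset`. -/
def StraightShape {L : Type} [PartialOrder L] (lam : Finset L) : Prop :=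
  ∀ a ∈ lam, ∀ b : L, b ≤ a → b ∈ lam

/-- The shape (set of boxes) of a partially defined tableau. -/
def shapeOf {L : Type} {V : Type} (T : L → Option V) : Set L := {α | T α ≠ none}

/-- `lam ⊆ nu` is a pair of straight shapes, defining the skew shape `nu / lam`. -/
def IsSkewPair {L : Type} [PartialOrder L] (lam nu : Finset L) : Prop :=
  StraightShape lam ∧ StraightShape nu ∧ lam ⊆ nu

/-- `T` is defined on a skew shape `nu / lam`. -/
def HasSkewShape {L : Type} [PartialOrder L] (T : L → Option ℤ) : Prop :=
  ∃ lam nu : Finset L, IsSkewPair lam nu ∧ shapeOf T = (nu : Set L) \ (lam : Set L)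

/-- `T` is strictly increasing along the partial order. -/
def Increasing {L : Type} [PartialOrder L] (T : L → Option ℤ) : Prop :=
  ∀ a b : L, a < b → ∀ x y : ℤ, T a = some x → T b = some y → x < y

/-- An increasing tableau of skew shape. -/
def IncreasingSkewTableau {L : Type} [PartialOrder L] (T : L → Option ℤ) : Prop :=
  HasSkewShape T ∧ Increasing T

/-- Two boxes are neighbors if one covers the other. -/
def Neighbor {L : Type} [PartialOrder L] (a b : L) : Prop := a ⋖ b ∨ b ⋖ a

/-- The swap operation `swap_{s,s'}`. -/
def swapVal {L : Type} [PartialOrder L] {V : Type} (s s' : V) (T : L → Option V) :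
    L → Option V := fun α =>
  if T α = some s ∧ ∃ β, Neighbor α β ∧ T β = some s' then some s'
  else if T α = some s' ∧ ∃ β, Neighbor α β ∧ T β = some s then some s
  else T α

/-- Integer values extended with a dot `•`. -/
abbrev ZDot : Type := ℤ ⊕ Unit

def toDotted {L : Type} (T : L → Option ℤ) : L → Option ZDot := fun α => (T α).map Sum.inl

/-- Place a dot in every box of `C`. -/
def addDots {L : Type} (C : Finset L) (T : L → Option ZDot) : L → Option ZDot := fun α =>
  if α ∈ C then some (Sum.inr ()) else T α

/-- Restrict a dotted tableau to its integer-valued boxes. -/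
def restrictInt {L : Type} (T : L → Option ZDot) : L → Option ℤ := fun α =>
  (T α).bind (Sum.elim some fun _ => none)

/-- Apply `swap_{a,•}, swap_{a+1,•}, …, swap_{a+n-1,•}` in this (increasing) order. -/
def swapUp {L : Type} [PartialOrder L] (a : ℤ) : ℕ → (L → Option ZDot) → (L → Option ZDot)
  | 0, T => T
  | n + 1, T => swapVal (Sum.inl (a + n)) (Sum.inr ()) (swapUp a n T)

/-- Apply `swap_{b,•}, swap_{b-1,•}, …, swap_{b-n+1,•}` in this (decreasing) order. -/
def swapDown {L : Type} [PartialOrder L] (b : ℤ) : ℕ → (L → Option ZDot) → (L → Option ZDot)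
  | 0, T => T
  | n + 1, T => swapVal (Sum.inl (b - n)) (Sum.inr ()) (swapDown b n T)

/-- All values of `T` lie in the interval `[a, b]`. -/
def ValuesIn {L : Type} (T : L → Option ℤ) (a b : ℤ) : Prop :=
  ∀ (α : L) (x : ℤ), T α = some x → a ≤ x ∧ x ≤ b

/-- `T'` is obtained from `T` by a single forward jeu de taquin slide `jdt_C`,
starting from a set `C` of maximal boxes of the inner shape. -/
def IsForwardSlide {L : Type} [PartialOrder L] (T T' : L → Option ℤ) : Prop :=
  ∃ (lam nu C : Finset L) (a b : ℤ),
    IsSkewPair lam nu ∧ shapeOf T = (nu : Set L) \ (lam : Set L) ∧ ValuesIn T a b ∧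
    (∀ c ∈ C, c ∈ lam ∧ ∀ d ∈ lam, ¬ c < d) ∧
    T' = restrictInt (swapUp a (b - a + 1).toNat (addDots C (toDotted T)))

/-- `T'` is obtained from `T` by a single reverse jeu de taquin slide,
starting from a set `C` of minimal boxes of the complement of the outer shape. -/
def IsReverseSlide {L : Type} [PartialOrder L] (T T' : L → Option ℤ) : Prop :=
  ∃ (lam nu C : Finset L) (a b : ℤ),
    IsSkewPair lam nu ∧ shapeOf T = (nu : Set L) \ (lam : Set L) ∧ ValuesIn T a b ∧
    (∀ c ∈ C, c ∉ nu ∧ ∀ d : L, d ∉ nu → ¬ d < c) ∧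
    T' = restrictInt (swapDown b (b - a + 1).toNat (addDots C (toDotted T)))

/-- Jeu de taquin equivalence: a finite sequence of forward and reverse slides. -/
def JdtEquiv {L : Type} [PartialOrder L] (T T' : L → Option ℤ) : Prop :=
  Relation.ReflTransGen (fun A B => IsForwardSlide A B ∨ IsReverseSlide A B) T T'

/-- `T` is defined on a straight shape. -/
def HasStraightShape {L : Type} [PartialOrder L] (T : L → Option ℤ) : Prop :=
  ∃ lam : Finset L, StraightShape lam ∧ shapeOf T = (lam : Set L)

/-- `U` is a rectification of `T`: a straight-shape tableau obtained by forward slides. -/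
def RectifiesTo {L : Type} [PartialOrder L] (T U : L → Option ℤ) : Prop :=
  Relation.ReflTransGen IsForwardSlide T U ∧ HasStraightShape U

/-- Unique rectification target. -/
def IsURT {L : Type} [PartialOrder L] (U : L → Option ℤ) : Prop :=
  HasStraightShape U ∧ Increasing U ∧
    ∀ T : L → Option ℤ, IncreasingSkewTableau T → RectifiesTo T U →
      ∀ U' : L → Option ℤ, RectifiesTo T U' → U' = U

/-- The minimal increasing tableau of a shape `θ`: each box `α` receives the maximal
cardinality of a totally ordered subset of `θ` having `α` as its maximal element. -/
def minTab {L : Type} [PartialOrder L] (θ : Finset L) : L → Option ℤ := fun α =>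
  if α ∈ θ then
    some ((sSup {n : ℕ | ∃ s : Finset L, (s : Set L) ⊆ (θ : Set L) ∧
      (∀ a ∈ s, ∀ b ∈ s, a ≤ b ∨ b ≤ a) ∧ α ∈ s ∧ (∀ a ∈ s, a ≤ α) ∧ s.card = n} : ℕ) : ℤ)
  else none

/-- A unique rectification poset. -/
def IsURP (L : Type) [PartialOrder L] : Prop :=
  ∀ lam : Finset L, StraightShape lam → IsURT (minTab lam)

/-- The structure constant `c^ν_{λ,μ}`: the number of increasing tableaux of
shape `ν/λ` that have the minimal increasing tableau `M_μ` as a rectification. -/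
def ccoef {L : Type} [PartialOrder L] (lam mu nu : Finset L) : ℕ :=
  Set.ncard {T : L → Option ℤ | Increasing T ∧ shapeOf T = (nu : Set L) \ (lam : Set L) ∧
    RectifiesTo T (minTab mu)}

/-- A set of tableaux is locally finite if all its members take values in one
common finite interval. -/
def LocallyFiniteSet {L : Type} (τ : Set (L → Option ℤ)) : Prop :=
  ∃ a b : ℤ, ∀ T ∈ τ, ValuesIn T a b

/-- A set of tableaux closed under forward and reverse jeu de taquin slides. -/
def JdtClosed {L : Type} [PartialOrder L] (τ : Set (L → Option ℤ)) : Prop :=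
  ∀ T ∈ τ, ∀ T' : L → Option ℤ, (IsForwardSlide T T' ∨ IsReverseSlide T T') → T' ∈ τ

/-- `τ(ν/λ)`: the number of tableaux in `τ` of shape `ν/λ`. -/
def tcount {L : Type} [PartialOrder L] (τ : Set (L → Option ℤ)) (lam nu : Finset L) : ℕ :=
  Set.ncard {T ∈ τ | shapeOf T = (nu : Set L) \ (lam : Set L)}

/-- Successive application of `g 0, g 1, …, g (n - 1)`. -/
def applySeq {X : Type} (g : ℕ → X → X) : ℕ → X → X
  | 0, x => x
  | n + 1, x => g n (applySeq g n x)

theorem applySeq_comm {X : Type} {g : ℕ → X → X} {h : X → X} {n : ℕ}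
    (hc : ∀ i < n, ∀ x, g i (h x) = h (g i x)) (x : X) :
    applySeq g n (h x) = h (applySeq g n x) := by
  induction n with
  | zero => rfl
  | succ n ih =>
    simp only [applySeq]
    rw [ih fun i hi => hc i (by omega), hc n (by omega)]

theorem applySeq_grid_swap {X : Type} (f : ℕ → ℕ → X → X)
    (hf : ∀ i i' j j', i ≠ i' → j ≠ j' → ∀ x, f i j (f i' j' x) = f i' j' (f i j x))
    (m n : ℕ) (x : X) :
    applySeq (fun i => applySeq (f i) n) m x =
      applySeq (fun j => applySeq (fun i => f i j) m) n x := by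
  have add_row : ∀ m n, applySeq (fun j => applySeq (fun i => f i j) (m + 1)) n x =
      applySeq (f m) n (applySeq (fun j => applySeq (fun i => f i j) m) n x) := by
    intro m n
    induction n with
    | zero => rfl
    | succ n ih =>
      change f m n (applySeq (fun i => f i n) m
        (applySeq (fun j => applySeq (fun i => f i j) (m + 1)) n x)) = f m n _
      rw [ih]
      congr 1
      refine (applySeq_comm (fun j hj y => ?_) _).symm
      refine (applySeq_comm (fun i hi z => ?_) _).symm
      exact hf i m n j (by omega) (by omega) z
  induction m with
  | zero =>
    induction n with
    | zero => rfl
    | succ n ih => exact ih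
  | succ m ih =>
    rw [add_row, ← ih]
    rfl

theorem swapUp_eq_applySeq {L : Type} [PartialOrder L] (a : ℤ) (n : ℕ) (T : L → Option ZDot) :
    swapUp a n T = applySeq (fun j => swapVal (Sum.inl (a + j)) (Sum.inr ())) n T := by
  induction n with
  | zero => rfl
  | succ n ih => simp only [swapUp, applySeq, ih]

theorem swapDown_eq_applySeq {L : Type} [PartialOrder L] (b : ℤ) (n : ℕ) (T : L → Option ZDot) :
    swapDown b n T = applySeq (fun i => swapVal (Sum.inl (b - i)) (Sum.inr ())) n T := by
  induction n with
  | zero => rfl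
  | succ n ih => simp only [swapDown, applySeq, ih]

theorem Neighbor.symm {L : Type} [PartialOrder L] {a b : L} (h : Neighbor a b) : Neighbor b a :=
  Or.symm h

theorem swapVal_symm {L V : Type} [PartialOrder L] {s s' : V} (_ : s ≠ s') (T : L → Option V) :
    swapVal s s' T = swapVal s' s T := by
  funext α
  unfold swapVal
  split_ifs with h1 h2 <;> simp_all

theorem swapVal_eq_none {L V : Type} [PartialOrder L] {s s' : V} {T : L → Option V} {α : L} :
    swapVal s s' T α = none ↔ T α = none := by
  unfold swapVal
  split_ifs with h1 h2 <;> simp_all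

theorem shapeOf_swapVal {L V : Type} [PartialOrder L] (s s' : V) (T : L → Option V) :
    shapeOf (swapVal s s' T) = shapeOf T := by
  ext α
  simp only [shapeOf, Set.mem_ofPred_eq, ne_eq, swapVal_eq_none]

theorem swapVal_eq_some {L V : Type} [PartialOrder L] {s s' v : V} {T : L → Option V} {α : L}
    (h : swapVal s s' T α = some v) :
    (v = s' ∧ T α = some s ∧ ∃ β, Neighbor α β ∧ T β = some s') ∨
    (v = s ∧ T α = some s' ∧ ∃ β, Neighbor α β ∧ T β = some s) ∨
    (T α = some v ∧ (v = s → ∀ β, Neighbor α β → T β ≠ some s') ∧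
      (v = s' → ∀ β, Neighbor α β → T β ≠ some s)) := by
  unfold swapVal at h
  split_ifs at h with h1 h2
  · exact Or.inl ⟨by simpa using h.symm, h1⟩
  · exact Or.inr (Or.inl ⟨by simpa using h.symm, h2⟩)
  · refine Or.inr (Or.inr ⟨h, ?_, ?_⟩)
    · rintro rfl β hβ hT
      exact h1 ⟨h, β, hβ, hT⟩
    · rintro rfl β hβ hT
      exact h2 ⟨h, β, hβ, hT⟩

theorem swapVal_apply_of_ne {L V : Type} [PartialOrder L] {s s' : V} {T : L → Option V} {α : L}
    (h : T α ≠ some s) (h' : T α ≠ some s') : swapVal s s' T α = T α := by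
  simp [swapVal, h, h']

theorem swapVal_eq_some_iff_of_ne {L V : Type} [PartialOrder L] {s s' v : V}
    (h : v ≠ s) (h' : v ≠ s') (T : L → Option V) (α : L) :
    swapVal s s' T α = some v ↔ T α = some v := by
  unfold swapVal
  split_ifs with h1 h2 <;> simp_all [eq_comm]

theorem swapVal_swapVal_comm {L V : Type} [PartialOrder L] {s s' u u' : V}
    (h1 : s ≠ u) (h2 : s ≠ u') (h3 : s' ≠ u) (h4 : s' ≠ u') (T : L → Option V) :
    swapVal s s' (swapVal u u' T) = swapVal u u' (swapVal s s' T) := by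
  have e1 := swapVal_eq_some_iff_of_ne (L := L) h1 h2 T
  have e2 := swapVal_eq_some_iff_of_ne (L := L) h3 h4 T
  have e3 := swapVal_eq_some_iff_of_ne (L := L) h1.symm h3.symm T
  have e4 := swapVal_eq_some_iff_of_ne (L := L) h2.symm h4.symm T
  funext α
  rw [swapVal.eq_def s s' (swapVal u u' T), swapVal.eq_def u u' (swapVal s s' T)]
  simp only [e1, e2, e3, e4]
  unfold swapVal
  split_ifs <;> simp_all

theorem swapVal_swapVal_self {L V : Type} [PartialOrder L] {s s' : V} {T : L → Option V}
    (hss : s ≠ s') (hT : ∀ α β v, Neighbor α β → T α = some v → T β ≠ some v) :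
    swapVal s s' (swapVal s s' T) = T := by
  funext α
  by_cases hs : T α = some s
  · by_cases hn : ∃ β, Neighbor α β ∧ T β = some s'
    · obtain ⟨β, hβ, hTβ⟩ := hn
      have hα : swapVal s s' T α = some s' := if_pos ⟨hs, β, hβ, hTβ⟩
      have hβ' : swapVal s s' T β = some s := by
        rw [swapVal_symm hss]
        exact if_pos ⟨hTβ, α, hβ.symm, hs⟩
      rw [swapVal_symm hss]
      exact (if_pos ⟨hα, β, hβ, hβ'⟩).trans hs.symm
    · have hα : swapVal s s' T α = some s := by simp [swapVal, hs, hn, hss]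
      have hn' : ¬ ∃ β, Neighbor α β ∧ swapVal s s' T β = some s' := by
        rintro ⟨β, hβ, hTβ⟩
        rcases swapVal_eq_some hTβ with h | h | h
        · exact hT α β s hβ hs h.2.1
        · exact hss h.1.symm
        · exact hn ⟨β, hβ, h.1⟩
      rw [swapVal.eq_def s s' (swapVal s s' T)]
      simp [hα, hn', hss, hs]
  · by_cases hs' : T α = some s'
    · by_cases hn : ∃ β, Neighbor α β ∧ T β = some s
      · obtain ⟨β, hβ, hTβ⟩ := hn
        have hα : swapVal s s' T α = some s := by
          rw [swapVal_symm hss]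
          exact if_pos ⟨hs', β, hβ, hTβ⟩
        have hβ' : swapVal s s' T β = some s' := if_pos ⟨hTβ, α, hβ.symm, hs'⟩
        exact (if_pos ⟨hα, β, hβ, hβ'⟩).trans hs'.symm
      · have hα : swapVal s s' T α = some s' := by simp [swapVal, hs', hn]
        have hn' : ¬ ∃ β, Neighbor α β ∧ swapVal s s' T β = some s := by
          rintro ⟨β, hβ, hTβ⟩
          rcases swapVal_eq_some hTβ with h | h | h
          · exact hss h.1
          · exact hT α β s' hβ hs' h.2.1
          · exact hn ⟨β, hβ, h.1⟩
        rw [swapVal.eq_def s s' (swapVal s s' T)]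
        simp [hα, hn', hs']
    · have hα := swapVal_apply_of_ne hs hs'
      rw [swapVal_apply_of_ne (by rwa [hα]) (by rwa [hα]), hα]

theorem swapVal_bind {L V W : Type} [PartialOrder L] (g : V → Option W) {s s' : V} {w w' : W}
    (hs : ∀ v, g v = some w ↔ v = s) (hs' : ∀ v, g v = some w' ↔ v = s') (T : L → Option V) :
    (fun α => (swapVal s s' T α).bind g) = swapVal w w' (fun α => (T α).bind g) := by
  have key : ∀ β, (T β).bind g = some w ↔ T β = some s := by
    intro β
    cases h : T β <;> simp [hs]
  have key' : ∀ β, (T β).bind g = some w' ↔ T β = some s' := by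
    intro β
    cases h : T β <;> simp [hs']
  funext α
  unfold swapVal
  simp only [key, key']
  split_ifs
  · exact (hs' s').2 rfl
  · exact (hs s).2 rfl
  · rfl

theorem applySeq_bind {L V W : Type} (g : V → Option W) {f : ℕ → (L → Option V) → L → Option V}
    {f' : ℕ → (L → Option W) → L → Option W}
    (h : ∀ i T, (fun α => (f i T α).bind g) = f' i (fun α => (T α).bind g))
    (n : ℕ) (T : L → Option V) :
    (fun α => (applySeq f n T α).bind g) = applySeq f' n (fun α => (T α).bind g) := by
  induction n with
  | zero => rfl
  | succ n ih => rw [applySeq, h, ih, applySeq]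

/-- Values of a pair of tableaux placed in one filling: `inl` for the first, `inr` for the
second. -/
abbrev PairVal : Type := ℤ ⊕ ℤ

/-- The relation on `PairVal` which is `<` on each summand, and in which `inr t` precedes `inl s`
exactly when the pair `(s, t)` has been swapped, that is, when `D s t` holds. -/
def pairLT (D : ℤ → ℤ → Prop) : PairVal → PairVal → Prop
  | Sum.inl s, Sum.inl s' => s < s'
  | Sum.inr t, Sum.inr t' => t < t'
  | Sum.inl s, Sum.inr t => ¬ D s t
  | Sum.inr t, Sum.inl s => D s t

/-- The filling `U` increases along covers with respect to `pairLT D`. -/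
def CoverIncreasing {L : Type} [PartialOrder L] (D : ℤ → ℤ → Prop) (U : L → Option PairVal) :
    Prop :=
  ∀ α β, α ⋖ β → ∀ u v, U α = some u → U β = some v → pairLT D u v

theorem not_pairLT_self (D : ℤ → ℤ → Prop) (u : PairVal) : ¬ pairLT D u u := by
  cases u <;> simp [pairLT]

theorem CoverIncreasing.neighbor_ne {L : Type} [PartialOrder L] {D : ℤ → ℤ → Prop}
    {U : L → Option PairVal} (h : CoverIncreasing D U) (α β : L) (v : PairVal)
    (hn : Neighbor α β) (hα : U α = some v) : U β ≠ some v := by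
  intro hβ
  rcases hn with hn | hn
  · exact not_pairLT_self D v (h α β hn v v hα hβ)
  · exact not_pairLT_self D v (h β α hn v v hβ hα)

theorem CoverIncreasing.swap {L : Type} [PartialOrder L] {D D' : ℤ → ℤ → Prop} {s t : ℤ}
    {U : L → Option PairVal} (h : CoverIncreasing D U) (hst : ¬ D s t)
    (hs : ∀ x, x ≠ s → (D x t ↔ s < x)) (ht : ∀ y, y ≠ t → (D s y ↔ y < t))
    (hD : ∀ x y, D' x y ↔ D x y ∨ (x = s ∧ y = t)) :
    CoverIncreasing D' (swapVal (Sum.inl s) (Sum.inr t) U) := by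
  intro α β hαβ u v hu hv
  have hn : Neighbor α β := Or.inl hαβ
  rcases swapVal_eq_some hu with ⟨rfl, hu, -⟩ | ⟨rfl, hu, -⟩ | ⟨hu, hu1, hu2⟩ <;>
  rcases swapVal_eq_some hv with ⟨rfl, hv, -⟩ | ⟨rfl, hv, -⟩ | ⟨hv, hv1, hv2⟩ <;>
  have key := h α β hαβ _ _ hu hv <;>
  first
  | (simp only [pairLT, hD] at key ⊢; grind)
  | (rcases v with x | x <;> simp only [pairLT, hD] at key ⊢ <;> grind [Neighbor.symm])

theorem CoverIncreasing.congr {L : Type} [PartialOrder L] {D D' : ℤ → ℤ → Prop}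
    {U : L → Option PairVal} (h : CoverIncreasing D U)
    (hD : ∀ α β x y, U α = some (Sum.inl x) → U β = some (Sum.inr y) → (D x y ↔ D' x y)) :
    CoverIncreasing D' U := by
  intro α β hαβ u v hu hv
  have key := h α β hαβ u v hu hv
  rcases u with x | x <;> rcases v with y | y <;> simp only [pairLT] at key ⊢ <;> grind

theorem CoverIncreasing.swap_injective {L : Type} [PartialOrder L] {D : ℤ → ℤ → Prop}
    {s t : ℤ} {U U' : L → Option PairVal} (h : CoverIncreasing D U) (h' : CoverIncreasing D U')
    (he : swapVal (Sum.inl s) (Sum.inr t) U = swapVal (Sum.inl s) (Sum.inr t) U') : U = U' := by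
  have hne : (Sum.inl s : PairVal) ≠ Sum.inr t := Sum.inl_ne_inr
  rw [← swapVal_swapVal_self hne h.neighbor_ne, he, swapVal_swapVal_self hne h'.neighbor_ne]

theorem CoverIncreasing.pairLT_of_lt {L : Type} [PartialOrder L] {D : ℤ → ℤ → Prop}
    {U : L → Option PairVal} (h : CoverIncreasing D U) {lam nu : Finset L}
    (hsk : IsSkewPair lam nu) (hU : shapeOf U = (nu : Set L) \ (lam : Set L))
    (hD : ∀ u v w, pairLT D u v → pairLT D v w → pairLT D u w) (α β : L) (hαβ : α < β)
    (u v : PairVal) (hu : U α = some u) (hv : U β = some v) : pairLT D u v := by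
  obtain ⟨hl, hn, hln⟩ := hsk
  have hmem : ∀ γ, U γ ≠ none ↔ γ ∈ nu ∧ γ ∉ lam := fun γ => by
    have := Set.ext_iff.1 hU γ
    simpa [shapeOf] using this
  induction hk : (nu.filter (· < β)).card using Nat.strong_induction_on generalizing β v with
  | _ k ih =>
    have hα := (hmem α).1 (by simp [hu])
    have hβ := (hmem β).1 (by simp [hv])
    obtain ⟨γ, hαγ, hγ⟩ := (nu.filter (fun x => α ≤ x ∧ x < β)).exists_le_maximal
      (a := α) (by simp [hα.1, hαβ])
    have hγ1 := hγ.prop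
    simp only [Finset.mem_filter] at hγ1
    have hcov : γ ⋖ β := by
      refine ⟨hγ1.2.2, fun δ h1 h2 => ?_⟩
      have hδ : δ ∈ nu.filter (fun x => α ≤ x ∧ x < β) := by
        simp only [Finset.mem_filter]
        exact ⟨hn β hβ.1 δ h2.le, hαγ.trans h1.le, h2⟩
      exact absurd (hγ.le_of_ge hδ h1.le) (not_le_of_gt h1)
    rcases eq_or_lt_of_le hαγ with rfl | hlt
    · exact h _ _ hcov u v hu hv
    · obtain ⟨w, hw⟩ := Option.ne_none_iff_exists'.1
        ((hmem γ).2 ⟨hγ1.1, fun hc => hα.2 (hl γ hc α hαγ)⟩)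
      refine hD u w v (ih _ ?_ γ hlt w hw rfl) (h _ _ hcov w v hw hv)
      rw [← hk]
      refine Finset.card_lt_card (Finset.ssubset_iff_of_subset ?_ |>.2 ⟨γ, ?_, ?_⟩)
      · intro x hx
        simp only [Finset.mem_filter] at hx ⊢
        exact ⟨hx.1, hx.2.trans hcov.lt⟩
      · simpa using ⟨hγ1.1, hcov.lt⟩
      · simp

theorem applySeq_induct {X : Type} {g : ℕ → X → X} {P : ℕ → X → Prop} {n : ℕ}
    (hP : ∀ i < n, ∀ x, P i x → P (i + 1) (g i x)) {x : X} (hx : P 0 x) :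
    P n (applySeq g n x) := by
  induction n with
  | zero => exact hx
  | succ n ih => exact hP n (by omega) _ (ih fun i hi => hP i (by omega))

theorem applySeq_injective {X : Type} {g : ℕ → X → X} {P : ℕ → X → Prop} {n : ℕ}
    (hP : ∀ i < n, ∀ x, P i x → P (i + 1) (g i x))
    (hg : ∀ i < n, ∀ x y, P i x → P i y → g i x = g i y → x = y) {x y : X}
    (hx : P 0 x) (hy : P 0 y) (he : applySeq g n x = applySeq g n y) : x = y := by
  induction n with
  | zero => exact he
  | succ n ih =>
    have hP' : ∀ i < n, ∀ x, P i x → P (i + 1) (g i x) := fun i hi => hP i (by omega)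
    exact ih hP' (fun i hi => hg i (by omega))
      (hg n (by omega) _ _ (applySeq_induct hP' hx) (applySeq_induct hP' hy) he)

/-- Every value of `U'` is a value of `U`. -/
def ValuesSubset {L V : Type} (U U' : L → Option V) : Prop :=
  ∀ α v, U' α = some v → ∃ β, U β = some v

theorem valuesSubset_swapVal {L V : Type} [PartialOrder L] (s s' : V) (U : L → Option V) :
    ValuesSubset U (swapVal s s' U) := by
  intro α v h
  rcases swapVal_eq_some h with ⟨rfl, -, β, -, h⟩ | ⟨rfl, -, β, -, h⟩ | ⟨h, -⟩
  exacts [⟨β, h⟩, ⟨β, h⟩, ⟨α, h⟩]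

theorem ValuesSubset.trans {L V : Type} {U U' U'' : L → Option V} (h : ValuesSubset U U')
    (h' : ValuesSubset U' U'') : ValuesSubset U U'' := fun α v hv =>
  let ⟨β, hβ⟩ := h' α v hv
  h β v hβ

theorem ValuesSubset.applySeq {L V : Type} {g : ℕ → (L → Option V) → L → Option V}
    (hg : ∀ i U, ValuesSubset U (g i U)) (n : ℕ) (U : L → Option V) :
    ValuesSubset U (applySeq g n U) :=
  applySeq_induct (P := fun _ => ValuesSubset U) (fun i _ _ h => h.trans (hg i _))
    fun α _ h => ⟨α, h⟩

theorem shapeOf_applySeq {L V : Type} {g : ℕ → (L → Option V) → L → Option V}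
    (hg : ∀ i U, shapeOf (g i U) = shapeOf U) (n : ℕ) (U : L → Option V) :
    shapeOf (applySeq g n U) = shapeOf U :=
  applySeq_induct (P := fun _ U' => shapeOf U' = shapeOf U) (fun i _ _ h => (hg i _).trans h) rfl

/-- The tableau of first entries. -/
def leftPart {L : Type} (U : L → Option PairVal) : L → Option ℤ := fun α =>
  (U α).bind (Sum.elim some fun _ => none)

/-- The tableau of second entries. -/
def rightPart {L : Type} (U : L → Option PairVal) : L → Option ℤ := fun α =>
  (U α).bind (Sum.elim (fun _ => none) some)

theorem leftPart_eq_some {L : Type} {U : L → Option PairVal} {α : L} {s : ℤ} :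
    leftPart U α = some s ↔ U α = some (Sum.inl s) := by
  unfold leftPart
  rcases U α with _ | _ | _ <;> simp

theorem rightPart_eq_some {L : Type} {U : L → Option PairVal} {α : L} {t : ℤ} :
    rightPart U α = some t ↔ U α = some (Sum.inr t) := by
  unfold rightPart
  rcases U α with _ | _ | _ <;> simp

/-- Swap `inl s` with `inr c, …, inr (c + n - 1)`. -/
def swapRow {L : Type} [PartialOrder L] (s c : ℤ) (n : ℕ) :
    (L → Option PairVal) → L → Option PairVal :=
  applySeq (fun j => swapVal (Sum.inl s) (Sum.inr (c + j))) n

/-- Swap `inr t` with `inl b, …, inl (b - m + 1)`. -/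
def swapCol {L : Type} [PartialOrder L] (b t : ℤ) (m : ℕ) :
    (L → Option PairVal) → L → Option PairVal :=
  applySeq (fun i => swapVal (Sum.inl (b - i)) (Sum.inr t)) m

/-- All second entries lie in `[c, c + n)`. -/
def RightIn (c : ℤ) (n : ℕ) (U : L → Option PairVal) : Prop :=
  ∀ α t, U α = some (Sum.inr t) → c ≤ t ∧ t < c + n

/-- All first entries lie in `(b - m, b]`. -/
def LeftIn (b : ℤ) (m : ℕ) (U : L → Option PairVal) : Prop :=
  ∀ α s, U α = some (Sum.inl s) → b - m < s ∧ s ≤ b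

theorem RightIn.mono {c : ℤ} {n : ℕ} {U U' : L → Option PairVal} (h : RightIn c n U)
    (hs : ValuesSubset U U') : RightIn c n U' := fun α t ht =>
  let ⟨β, hβ⟩ := hs α _ ht
  h β t hβ

theorem LeftIn.mono {b : ℤ} {m : ℕ} {U U' : L → Option PairVal} (h : LeftIn b m U)
    (hs : ValuesSubset U U') : LeftIn b m U' := fun α t ht =>
  let ⟨β, hβ⟩ := hs α _ ht
  h β t hβ

theorem restrictInt_bind {L : Type} {U : L → Option PairVal} (g : PairVal → Option ZDot)
    (h : PairVal → Option ℤ) (hg : ∀ v, (g v).bind (Sum.elim some fun _ => none) = h v) :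
    restrictInt (fun α => (U α).bind g) = fun α => (U α).bind h := by
  funext α
  simp only [restrictInt]
  rcases U α with _ | v
  · rfl
  · exact hg v

section Row

variable {L : Type} [PartialOrder L]

theorem shapeOf_swapRow (s c : ℤ) (n : ℕ) (U : L → Option PairVal) :
    shapeOf (swapRow s c n U) = shapeOf U :=
  shapeOf_applySeq (fun _ => shapeOf_swapVal _ _) n U

theorem shapeOf_swapCol (b t : ℤ) (m : ℕ) (U : L → Option PairVal) :
    shapeOf (swapCol b t m U) = shapeOf U :=
  shapeOf_applySeq (fun _ => shapeOf_swapVal _ _) m U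

theorem valuesSubset_swapRow (s c : ℤ) (n : ℕ) (U : L → Option PairVal) :
    ValuesSubset U (swapRow s c n U) :=
  ValuesSubset.applySeq (fun _ => valuesSubset_swapVal _ _) n U

theorem valuesSubset_swapCol (b t : ℤ) (m : ℕ) (U : L → Option PairVal) :
    ValuesSubset U (swapCol b t m U) :=
  ValuesSubset.applySeq (fun _ => valuesSubset_swapVal _ _) m U

theorem CoverIncreasing.swapRow_step {s c : ℤ} (j : ℕ) (U : L → Option PairVal)
    (h : CoverIncreasing (fun x y => s < x ∨ (x = s ∧ y < c + j)) U) :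
    CoverIncreasing (fun x y => s < x ∨ (x = s ∧ y < c + (j + 1 : ℕ)))
      (swapVal (Sum.inl s) (Sum.inr (c + j)) U) := by
  refine h.swap ?_ ?_ ?_ ?_ <;> intros <;> push_cast <;> omega

theorem CoverIncreasing.swapCol_step {b t : ℤ} (i : ℕ) (U : L → Option PairVal)
    (h : CoverIncreasing (fun x y => y < t ∨ (y = t ∧ b - i < x)) U) :
    CoverIncreasing (fun x y => y < t ∨ (y = t ∧ b - (i + 1 : ℕ) < x))
      (swapVal (Sum.inl (b - i)) (Sum.inr t) U) := by
  refine h.swap ?_ ?_ ?_ ?_ <;> intros <;> push_cast <;> omega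

theorem CoverIncreasing.row_start {s c : ℤ} {n : ℕ} {U : L → Option PairVal}
    (h : CoverIncreasing (fun x _ => s < x) U) (hr : RightIn c n U) :
    CoverIncreasing (fun x y => s < x ∨ (x = s ∧ y < c + (0 : ℕ))) U :=
  h.congr fun _ β x y _ hy => by
    have := hr β y hy
    simp only [Nat.cast_zero]
    omega

theorem CoverIncreasing.swapRow {s c : ℤ} {n : ℕ} {U : L → Option PairVal}
    (h : CoverIncreasing (fun x _ => s < x) U) (hr : RightIn c n U) :
    CoverIncreasing (fun x _ => s - 1 < x) (swapRow s c n U) := by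
  have key := applySeq_induct (n := n) (fun j _ => CoverIncreasing.swapRow_step j)
    (h.row_start hr)
  refine key.congr fun _ β x y _ hy => ?_
  have := hr.mono (valuesSubset_swapRow s c n U) β y hy
  omega

theorem CoverIncreasing.swapRow_injective {s c : ℤ} {n : ℕ} {U U' : L → Option PairVal}
    (h : CoverIncreasing (fun x _ => s < x) U) (hr : RightIn c n U)
    (h' : CoverIncreasing (fun x _ => s < x) U') (hr' : RightIn c n U')
    (he : _root_.swapRow s c n U = _root_.swapRow s c n U') : U = U' :=
  applySeq_injective (n := n) (fun j _ => CoverIncreasing.swapRow_step j)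
    (fun _ _ _ _ hx hy => hx.swap_injective hy) (h.row_start hr) (h'.row_start hr') he

theorem CoverIncreasing.swapCol {b t : ℤ} {m : ℕ} {U : L → Option PairVal}
    (h : CoverIncreasing (fun _ y => y < t) U) (hr : LeftIn b m U) :
    CoverIncreasing (fun _ y => y < t + 1) (swapCol b t m U) := by
  have start : CoverIncreasing (fun x y => y < t ∨ (y = t ∧ b - (0 : ℕ) < x)) U :=
    h.congr fun α _ x y hx _ => by
      have := hr α x hx
      simp only [Nat.cast_zero]
      omega
  have key := applySeq_induct (n := m) (fun j _ => CoverIncreasing.swapCol_step j) start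
  refine key.congr fun α _ x y hx _ => ?_
  have := hr.mono (valuesSubset_swapCol b t m U) α x hx
  omega

theorem rightPart_swapRow (s c : ℤ) (n : ℕ) (U : L → Option PairVal) (C : Finset L)
    (hC : ∀ α, α ∈ C ↔ U α = some (Sum.inl s)) :
    rightPart (swapRow s c n U) =
      restrictInt (swapUp c n (addDots C (toDotted (rightPart U)))) := by
  set g : PairVal → Option ZDot :=
    Sum.elim (fun x => if x = s then some (Sum.inr ()) else none) fun y => some (Sum.inl y)
    with hg
  have h0 : addDots C (toDotted (rightPart U)) = fun α => (U α).bind g := by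
    funext α
    simp only [addDots, toDotted, rightPart, hC]
    rcases U α with _ | x | y <;> simp [hg]
  rw [h0, swapUp_eq_applySeq, ← applySeq_bind (g := g)
    (f := fun j => swapVal (Sum.inl s) (Sum.inr (c + j)))]
  · refine (restrictInt_bind g _ ?_).symm
    rintro (x | y)
    · by_cases hx : x = s <;> simp [hg, hx]
    · simp [hg]
  · intro j T
    rw [swapVal_symm Sum.inl_ne_inr]
    refine swapVal_bind g ?_ ?_ T <;> rintro (x | y) <;> simp [hg]

theorem leftPart_swapCol (b t : ℤ) (m : ℕ) (U : L → Option PairVal) (C : Finset L)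
    (hC : ∀ α, α ∈ C ↔ U α = some (Sum.inr t)) :
    leftPart (swapCol b t m U) =
      restrictInt (swapDown b m (addDots C (toDotted (leftPart U)))) := by
  set g : PairVal → Option ZDot :=
    Sum.elim (fun x => some (Sum.inl x)) fun y => if y = t then some (Sum.inr ()) else none
    with hg
  have h0 : addDots C (toDotted (leftPart U)) = fun α => (U α).bind g := by
    funext α
    simp only [addDots, toDotted, leftPart, hC]
    rcases U α with _ | x | y <;> simp [hg]
  rw [h0, swapDown_eq_applySeq, ← applySeq_bind (g := g)
    (f := fun i => swapVal (Sum.inl (b - i)) (Sum.inr t))]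
  · refine (restrictInt_bind g _ ?_).symm
    rintro (x | y)
    · simp [hg]
    · by_cases hy : y = t <;> simp [hg, hy]
  · intro j T
    refine swapVal_bind g ?_ ?_ T <;> rintro (x | y) <;> simp [hg]

end Row

/-- The union of `lam` with the boxes of `nu` whose value satisfies `P`. -/
def extendShape {L : Type} (lam nu : Finset L) (U : L → Option PairVal) (P : PairVal → Prop) :
    Finset L :=
  lam ∪ nu.filter (fun α => ∃ v, U α = some v ∧ P v)

theorem mem_of_shapeOf {L : Type} {lam nu : Finset L} {V : Type} {U : L → Option V}
    (hU : shapeOf U = (nu : Set L) \ (lam : Set L)) {α : L} {v : V} (h : U α = some v) :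
    α ∈ nu ∧ α ∉ lam := by
  have := (Set.ext_iff.1 hU α).1 (by simp [shapeOf, h])
  simpa using this

theorem exists_of_shapeOf {L : Type} {lam nu : Finset L} {V : Type} {U : L → Option V}
    (hU : shapeOf U = (nu : Set L) \ (lam : Set L)) {α : L} (h : α ∈ nu) (h' : α ∉ lam) :
    ∃ v, U α = some v :=
  Option.ne_none_iff_exists'.1 ((Set.ext_iff.1 hU α).2 (by simp [h, h']))

theorem extendShape_mono {L : Type} {lam nu : Finset L} {U : L → Option PairVal}
    {P P' : PairVal → Prop}
    (h : ∀ v, P v → P' v) : extendShape lam nu U P ⊆ extendShape lam nu U P' :=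
  Finset.union_subset_union_right
    (Finset.monotone_filter_right _ fun _ _ ⟨v, hv, hp⟩ => ⟨v, hv, h v hp⟩)

theorem mem_extendShape {L : Type} {lam nu : Finset L} {U : L → Option PairVal}
    {P : PairVal → Prop}
    (hU : shapeOf U = (nu : Set L) \ (lam : Set L)) {α : L} :
    α ∈ extendShape lam nu U P ↔ α ∈ lam ∨ ∃ v, U α = some v ∧ P v := by
  simp only [extendShape, Finset.mem_union, Finset.mem_filter]
  refine or_congr_right ⟨fun h => h.2, fun h => ⟨?_, h⟩⟩
  obtain ⟨v, hv, -⟩ := h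
  exact (mem_of_shapeOf hU hv).1

theorem shapeOf_part {L : Type} {lam nu : Finset L} {U : L → Option PairVal} {T : L → Option ℤ}
    {P P' : PairVal → Prop} (i : ℤ → PairVal)
    (hU : shapeOf U = (nu : Set L) \ (lam : Set L)) (hT : ∀ α t, T α = some t ↔ U α = some (i t))
    (hP : ∀ v, (∃ t, v = i t) ↔ P' v ∧ ¬ P v) :
    shapeOf T = (extendShape lam nu U P' : Set L) \ (extendShape lam nu U P : Set L) := by
  ext α
  have h1 : α ∈ shapeOf T ↔ ∃ t, U α = some (i t) := by
    simp only [shapeOf, Set.mem_ofPred_eq, Option.ne_none_iff_exists', hT]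
  simp only [h1, Set.mem_sdiff, Finset.mem_coe, mem_extendShape hU]
  rcases hα : U α with _ | v
  · simp
  · have h2 := (mem_of_shapeOf hU hα).2
    simp [h2, ← hP]

section Shape

variable {L : Type} [PartialOrder L]

theorem CoverIncreasing.straightShape_extendShape {D : ℤ → ℤ → Prop} {U : L → Option PairVal}
    {lam nu : Finset L} {P : PairVal → Prop} (h : CoverIncreasing D U) (hsk : IsSkewPair lam nu)
    (hU : shapeOf U = (nu : Set L) \ (lam : Set L))
    (hD : ∀ u v w, pairLT D u v → pairLT D v w → pairLT D u w)
    (hP : ∀ u v, pairLT D u v → P v → P u) : StraightShape (extendShape lam nu U P) := by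
  intro α hα β hβ
  rw [mem_extendShape hU] at hα ⊢
  rcases hα with hα | ⟨v, hv, hPv⟩
  · exact Or.inl (hsk.1 α hα β hβ)
  · by_cases hl : β ∈ lam
    · exact Or.inl hl
    obtain ⟨u, hu⟩ := exists_of_shapeOf hU (hsk.2.1 α (mem_of_shapeOf hU hv).1 β hβ) hl
    refine Or.inr ⟨u, hu, ?_⟩
    rcases eq_or_lt_of_le hβ with rfl | hlt
    · rw [hu] at hv
      cases hv
      exact hPv
    · exact hP u v (h.pairLT_of_lt hsk hU hD β α hlt u v hu hv) hPv

theorem pairLT_trans_of_left {s : ℤ} (u v w : PairVal) (h : pairLT (fun x _ => s < x) u v)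
    (h' : pairLT (fun x _ => s < x) v w) : pairLT (fun x _ => s < x) u w := by
  rcases u with u | u <;> rcases v with v | v <;> rcases w with w | w <;>
    simp only [pairLT] at h h' ⊢ <;> omega

theorem pairLT_trans_of_right {t : ℤ} (u v w : PairVal) (h : pairLT (fun _ y => y < t) u v)
    (h' : pairLT (fun _ y => y < t) v w) : pairLT (fun _ y => y < t) u w := by
  rcases u with u | u <;> rcases v with v | v <;> rcases w with w | w <;>
    simp only [pairLT] at h h' ⊢ <;> omega

theorem pairLT_trans_of_true (u v w : PairVal) (h : pairLT (fun _ _ => True) u v)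
    (h' : pairLT (fun _ _ => True) v w) : pairLT (fun _ _ => True) u w := by
  rcases u with u | u <;> rcases v with v | v <;> rcases w with w | w <;>
    simp only [pairLT] at h h' ⊢ <;> first | omega | tauto

theorem isForwardSlide_swapRow {lam nu : Finset L} {U : L → Option PairVal} {s c : ℤ} {n : ℕ}
    (hsk : IsSkewPair lam nu) (hU : shapeOf U = (nu : Set L) \ (lam : Set L))
    (h : CoverIncreasing (fun x _ => s < x) U) (hr : RightIn c n U) :
    IsForwardSlide (rightPart U) (rightPart (swapRow s c n U)) := by
  have hn : (c + n - 1 - c + 1).toNat = n := by omega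
  refine ⟨extendShape lam nu U (Sum.elim (· ≤ s) fun _ => False),
    extendShape lam nu U (Sum.elim (· ≤ s) fun _ => True),
    nu.filter (U · = some (Sum.inl s)), c, c + n - 1, ⟨?_, ?_, ?_⟩, ?_, ?_, ?_, ?_⟩
  · refine h.straightShape_extendShape hsk hU pairLT_trans_of_left ?_
    rintro (u | u) (v | v) <;> simp only [pairLT, Sum.elim_inl, Sum.elim_inr] <;> grind
  · refine h.straightShape_extendShape hsk hU pairLT_trans_of_left ?_
    rintro (u | u) (v | v) <;> simp only [pairLT, Sum.elim_inl, Sum.elim_inr] <;> grind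
  · refine extendShape_mono ?_
    rintro (v | v) <;> simp
  · refine shapeOf_part Sum.inr hU (fun _ _ => rightPart_eq_some) ?_
    rintro (v | v) <;> simp
  · intro α t ht
    have := hr α t (rightPart_eq_some.1 ht)
    omega
  · intro α hα
    have hα' := (Finset.mem_filter.1 hα).2
    refine ⟨(mem_extendShape hU).2 (Or.inr ⟨_, hα', by simp⟩), fun d hd hlt => ?_⟩
    rcases (mem_extendShape hU).1 hd with hd | ⟨v, hv, hP⟩
    · exact (mem_of_shapeOf hU hα').2 (hsk.1 d hd α hlt.le)
    · have key := h.pairLT_of_lt hsk hU pairLT_trans_of_left α d hlt _ v hα' hv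
      rcases v with v | v <;> simp only [pairLT, Sum.elim_inl, Sum.elim_inr] at key hP
      omega
  · rw [hn]
    refine rightPart_swapRow s c n U _ fun α => ?_
    simp only [Finset.mem_filter, and_iff_right_iff_imp]
    exact fun hα => (mem_of_shapeOf hU hα).1

theorem isReverseSlide_swapCol {lam nu : Finset L} {U : L → Option PairVal} {b t : ℤ} {m : ℕ}
    (hsk : IsSkewPair lam nu) (hU : shapeOf U = (nu : Set L) \ (lam : Set L))
    (h : CoverIncreasing (fun _ y => y < t) U) (hr : LeftIn b m U) :
    IsReverseSlide (leftPart U) (leftPart (swapCol b t m U)) := by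
  have hm : (b - (b - m + 1) + 1).toNat = m := by omega
  refine ⟨extendShape lam nu U (Sum.elim (fun _ => False) (· < t)),
    extendShape lam nu U (Sum.elim (fun _ => True) (· < t)),
    nu.filter (U · = some (Sum.inr t)), b - m + 1, b, ⟨?_, ?_, ?_⟩, ?_, ?_, ?_, ?_⟩
  · refine h.straightShape_extendShape hsk hU pairLT_trans_of_right ?_
    rintro (u | u) (v | v) <;> simp only [pairLT, Sum.elim_inl, Sum.elim_inr] <;> grind
  · refine h.straightShape_extendShape hsk hU pairLT_trans_of_right ?_
    rintro (u | u) (v | v) <;> simp only [pairLT, Sum.elim_inl, Sum.elim_inr] <;> grind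
  · refine extendShape_mono ?_
    rintro (v | v) <;> simp
  · refine shapeOf_part Sum.inl hU (fun _ _ => leftPart_eq_some) ?_
    rintro (v | v) <;> simp
  · intro α x hx
    have := hr α x (leftPart_eq_some.1 hx)
    omega
  · intro α hα
    have hα' := (Finset.mem_filter.1 hα).2
    obtain ⟨hn1, hn2⟩ := mem_of_shapeOf hU hα'
    refine ⟨?_, fun d hd hlt => ?_⟩
    · rw [mem_extendShape hU]
      rintro (hl | ⟨v, hv, hP⟩)
      · exact hn2 hl
      · rw [hα'] at hv
        cases hv
        simp at hP
    · rw [mem_extendShape hU] at hd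
      push Not at hd
      obtain ⟨v, hv⟩ := exists_of_shapeOf hU (hsk.2.1 α hn1 d hlt.le) hd.1
      have key := h.pairLT_of_lt hsk hU pairLT_trans_of_right d α hlt v _ hv hα'
      have hP := hd.2 v hv
      rcases v with v | v <;> simp only [pairLT, Sum.elim_inl, Sum.elim_inr] at key hP <;> tauto
  · rw [hm]
    refine leftPart_swapCol b t m U _ fun α => ?_
    simp only [Finset.mem_filter, and_iff_right_iff_imp]
    exact fun hα => (mem_of_shapeOf hU hα).1

/-- Tableau switching: swap all pairs of first and second entries. -/
def switch (b : ℤ) (m : ℕ) (c : ℤ) (n : ℕ) : (L → Option PairVal) → L → Option PairVal :=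
  applySeq (fun i => swapRow (b - i) c n) m

theorem switch_eq_applySeq_swapCol (b : ℤ) (m : ℕ) (c : ℤ) (n : ℕ) (U : L → Option PairVal) :
    switch b m c n U = applySeq (fun j => swapCol b (c + j) m) n U :=
  applySeq_grid_swap (fun (i j : ℕ) => swapVal (Sum.inl (b - i)) (Sum.inr (c + j)))
    (fun i i' j j' hi hj x => swapVal_swapVal_comm (by simp; omega) (by simp) (by simp)
      (by simp; omega) x) m n U

/-- The state of the forward slides: the second entries form a tableau in `σ`, and have been
exchanged with the first entries exceeding `s`. -/
structure RowState (σ : Set (L → Option ℤ)) (lam nu : Finset L) (c : ℤ) (n : ℕ) (s : ℤ)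
    (U : L → Option PairVal) : Prop where
  shape : shapeOf U = (nu : Set L) \ (lam : Set L)
  right_in : RightIn c n U
  increasing : CoverIncreasing (fun x _ => s < x) U
  right_mem : rightPart U ∈ σ

/-- The state of the reverse slides: the first entries form a tableau in `τ`, and have been
exchanged with the second entries smaller than `t`. -/
structure ColState (τ : Set (L → Option ℤ)) (lam nu : Finset L) (b : ℤ) (m : ℕ) (t : ℤ)
    (U : L → Option PairVal) : Prop where
  shape : shapeOf U = (nu : Set L) \ (lam : Set L)
  left_in : LeftIn b m U
  increasing : CoverIncreasing (fun _ y => y < t) U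
  left_mem : leftPart U ∈ τ

variable {σ τ : Set (L → Option ℤ)} {lam nu : Finset L} {b c s t : ℤ} {m n : ℕ}

theorem RowState.swapRow (hσ : JdtClosed σ) (hsk : IsSkewPair lam nu) {U : L → Option PairVal}
    (h : RowState σ lam nu c n s U) : RowState σ lam nu c n (s - 1) (swapRow s c n U) where
  shape := (shapeOf_swapRow s c n U).trans h.shape
  right_in := h.right_in.mono (valuesSubset_swapRow s c n U)
  increasing := h.increasing.swapRow h.right_in
  right_mem := hσ _ h.right_mem _
    (Or.inl (isForwardSlide_swapRow hsk h.shape h.increasing h.right_in))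

theorem ColState.swapCol (hτ : JdtClosed τ) (hsk : IsSkewPair lam nu) {U : L → Option PairVal}
    (h : ColState τ lam nu b m t U) : ColState τ lam nu b m (t + 1) (swapCol b t m U) where
  shape := (shapeOf_swapCol b t m U).trans h.shape
  left_in := h.left_in.mono (valuesSubset_swapCol b t m U)
  increasing := h.increasing.swapCol h.left_in
  left_mem := hτ _ h.left_mem _
    (Or.inr (isReverseSlide_swapCol hsk h.shape h.increasing h.left_in))

theorem RowState.step (hσ : JdtClosed σ) (hsk : IsSkewPair lam nu) (i : ℕ)
    (U : L → Option PairVal) (h : RowState σ lam nu c n (b - i) U) :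
    RowState σ lam nu c n (b - (i + 1 : ℕ)) (_root_.swapRow (b - i) c n U) := by
  have := h.swapRow hσ hsk
  rwa [show b - i - 1 = b - (i + 1 : ℕ) by push_cast; ring] at this

theorem ColState.step (hτ : JdtClosed τ) (hsk : IsSkewPair lam nu) (j : ℕ)
    (U : L → Option PairVal) (h : ColState τ lam nu b m (c + j) U) :
    ColState τ lam nu b m (c + (j + 1 : ℕ)) (_root_.swapCol b (c + j) m U) := by
  have := h.swapCol hτ hsk
  rwa [show c + j + 1 = c + (j + 1 : ℕ) by push_cast; ring] at this

theorem RowState.switch (hσ : JdtClosed σ) (hsk : IsSkewPair lam nu) {U : L → Option PairVal}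
    (h : RowState σ lam nu c n b U) :
    RowState σ lam nu c n (b - m) (switch b m c n U) :=
  applySeq_induct (P := fun i => RowState σ lam nu c n (b - i))
    (fun i _ => RowState.step hσ hsk i) (by simpa using h)

theorem ColState.switch (hτ : JdtClosed τ) (hsk : IsSkewPair lam nu) {U : L → Option PairVal}
    (h : ColState τ lam nu b m c U) :
    ColState τ lam nu b m (c + n) (switch b m c n U) := by
  rw [switch_eq_applySeq_swapCol]
  exact applySeq_induct (P := fun j => ColState τ lam nu b m (c + j))
    (fun j _ => ColState.step hτ hsk j) (by simpa using h)

theorem RowState.switch_injective (hσ : JdtClosed σ) (hsk : IsSkewPair lam nu)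
    {U U' : L → Option PairVal} (h : RowState σ lam nu c n b U) (h' : RowState σ lam nu c n b U')
    (he : _root_.switch b m c n U = _root_.switch b m c n U') : U = U' :=
  applySeq_injective (P := fun i => RowState σ lam nu c n (b - i))
    (fun i _ => RowState.step hσ hsk i)
    (fun _ _ _ _ hx hy => hx.increasing.swapRow_injective hx.right_in hy.increasing hy.right_in)
    (by simpa using h) (by simpa using h') he

end Shape

/-- Two tableaux combined into one filling. -/
def pairUp {L : Type} (S T : L → Option ℤ) : L → Option PairVal := fun α =>
  ((S α).map Sum.inl).or ((T α).map Sum.inr)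

theorem leftPart_pairUp {L : Type} (S T : L → Option ℤ) : leftPart (pairUp S T) = S := by
  funext α
  unfold leftPart pairUp
  rcases S α with _ | _ <;> rcases T α with _ | _ <;> rfl

theorem pairUp_parts {L : Type} (U : L → Option PairVal) :
    pairUp (leftPart U) (rightPart U) = U := by
  funext α
  simp only [leftPart, rightPart, pairUp]
  rcases U α with _ | _ | _ <;> rfl

theorem rightPart_pairUp {L : Type} {S T : L → Option ℤ}
    (h : ∀ α, S α = none ∨ T α = none) : rightPart (pairUp S T) = T := by
  funext α
  have := h α
  unfold rightPart pairUp
  rcases hS : S α with _ | _ <;> rcases hT : T α with _ | _ <;> simp_all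

theorem shapeOf_pairUp {L : Type} {lam mu nu : Finset L} {S T : L → Option ℤ}
    (hlm : lam ⊆ mu) (hmn : mu ⊆ nu)
    (hS : shapeOf S = (mu : Set L) \ (lam : Set L))
    (hT : shapeOf T = (nu : Set L) \ (mu : Set L)) :
    shapeOf (pairUp S T) = (nu : Set L) \ (lam : Set L) := by
  have h : shapeOf (pairUp S T) = shapeOf T ∪ shapeOf S := by
    ext α
    simp only [shapeOf, pairUp, Set.mem_union, Set.mem_ofPred_eq]
    rcases S α with _ | _ <;> rcases T α with _ | _ <;> simp
  rw [h, hS, hT]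
  exact Set.sdiff_union_sdiff_cancel (Finset.coe_subset.2 hmn) (Finset.coe_subset.2 hlm)

theorem disjoint_of_shapeOf {L : Type} {lam mu nu : Finset L} {S T : L → Option ℤ}
    (hS : shapeOf S = (mu : Set L) \ (lam : Set L))
    (hT : shapeOf T = (nu : Set L) \ (mu : Set L)) (α : L) : S α = none ∨ T α = none := by
  by_contra! h
  have h1 : α ∈ shapeOf S := h.1
  have h2 : α ∈ shapeOf T := h.2
  rw [hS] at h1
  rw [hT] at h2
  exact h2.2 h1.1

theorem finite_tableaux {L : Type} {σ : Set (L → Option ℤ)} (hσ : LocallyFiniteSet σ)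
    (lam nu : Finset L) :
    {T ∈ σ | shapeOf T = (nu : Set L) \ (lam : Set L)}.Finite := by
  obtain ⟨a, b, hab⟩ := hσ
  refine Set.Finite.of_finite_image (f := fun T (x : nu) => T x) ?_ ?_
  · refine (Set.Finite.pi' (t := fun _ : nu => insert none (some '' Set.Icc a b))
      fun _ => ((Set.finite_Icc a b).image _).insert _).subset ?_
    rintro _ ⟨T, ⟨hT, -⟩, rfl⟩ x
    rcases h : T x with _ | v
    · simp [h]
    · simpa [h] using hab T hT x v h
  · rintro T ⟨-, hT⟩ T' ⟨-, hT'⟩ he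
    funext α
    by_cases hα : α ∈ nu
    · exact congrFun he ⟨α, hα⟩
    · have h1 : ∀ {T'' : L → Option ℤ}, shapeOf T'' = (nu : Set L) \ (lam : Set L) →
          T'' α = none := by
        intro T'' h
        by_contra hc
        obtain ⟨v, hv⟩ := Option.ne_none_iff_exists'.1 hc
        exact hα (mem_of_shapeOf h hv).1
      rw [h1 hT, h1 hT']

section Count

variable {L : Type} [PartialOrder L] {σ τ : Set (L → Option ℤ)} {lam mu nu : Finset L}

theorem coverIncreasing_pairUp {S T : L → Option ℤ} {D : ℤ → ℤ → Prop} (hm : StraightShape mu)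
    (hS : shapeOf S = (mu : Set L) \ (lam : Set L)) (hT : shapeOf T = (nu : Set L) \ (mu : Set L))
    (hSi : Increasing S) (hTi : Increasing T)
    (hD : ∀ α β x y, S α = some x → T β = some y → ¬ D x y) :
    CoverIncreasing D (pairUp S T) := by
  intro α β hαβ u v hu hv
  have hr := rightPart_pairUp (disjoint_of_shapeOf hS hT)
  rcases u with x | x <;> rcases v with y | y <;>
    simp only [← leftPart_eq_some, ← rightPart_eq_some, leftPart_pairUp, hr] at hu hv
  · exact hSi α β hαβ.lt x y hu hv
  · exact hD α β x y hu hv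
  · exact absurd (hm β (mem_of_shapeOf hS hv).1 α hαβ.le) (mem_of_shapeOf hT hu).2
  · exact hTi α β hαβ.lt x y hu hv

/-- The straight shapes between `lam` and `nu`. -/
def straightBetween (lam nu : Finset L) : Finset (Finset L) :=
  nu.powerset.filter (fun m => lam ⊆ m ∧ StraightShape m)

/-- The pairs of tableaux in `σ` of shape `nu / mu` and in `τ` of shape `mu / lam`, for some
straight shape `mu`. -/
def tableauPairs (hσ : LocallyFiniteSet σ) (hτ : LocallyFiniteSet τ) (lam nu : Finset L) :
    Finset (Σ _ : Finset L, (L → Option ℤ) × (L → Option ℤ)) :=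
  (straightBetween lam nu).sigma fun mu =>
    (finite_tableaux hσ mu nu).toFinset ×ˢ (finite_tableaux hτ lam mu).toFinset

theorem card_tableauPairs (hσ : LocallyFiniteSet σ) (hτ : LocallyFiniteSet τ)
    (lam nu : Finset L) : (tableauPairs hσ hτ lam nu).card =
      ∑ mu ∈ straightBetween lam nu, tcount σ mu nu * tcount τ lam mu := by
  rw [tableauPairs, Finset.card_sigma]
  refine Finset.sum_congr rfl fun mu _ => ?_
  rw [Finset.card_product, tcount, tcount, Set.ncard_eq_toFinset_card _ (finite_tableaux hσ mu nu),
    Set.ncard_eq_toFinset_card _ (finite_tableaux hτ lam mu)]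

theorem mem_tableauPairs (hσ : LocallyFiniteSet σ) (hτ : LocallyFiniteSet τ)
    (p : Σ _ : Finset L, (L → Option ℤ) × (L → Option ℤ)) :
    p ∈ tableauPairs hσ hτ lam nu ↔ (p.1 ⊆ nu ∧ lam ⊆ p.1 ∧ StraightShape p.1) ∧
      (p.2.1 ∈ σ ∧ shapeOf p.2.1 = (nu : Set L) \ (p.1 : Set L)) ∧
      (p.2.2 ∈ τ ∧ shapeOf p.2.2 = (p.1 : Set L) \ (lam : Set L)) := by
  simp [tableauPairs, straightBetween]

theorem sum_tcount_le (hσi : ∀ T ∈ σ, IncreasingSkewTableau T)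
    (hτi : ∀ T ∈ τ, IncreasingSkewTableau T) (hσf : LocallyFiniteSet σ)
    (hτf : LocallyFiniteSet τ) (hσc : JdtClosed σ) (hτc : JdtClosed τ)
    (hsk : IsSkewPair lam nu) :
    ∑ mu ∈ straightBetween lam nu, tcount σ mu nu * tcount τ lam mu ≤
      ∑ mu ∈ straightBetween lam nu, tcount τ mu nu * tcount σ lam mu := by
  rw [← card_tableauPairs hσf hτf, ← card_tableauPairs hτf hσf]
  obtain ⟨a, b, hab⟩ := id hτf
  obtain ⟨c, d, hcd⟩ := id hσf
  set m := (b - a + 1).toNat with hm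
  set n := (d - c + 1).toNat with hn
  have init : ∀ p ∈ tableauPairs hσf hτf lam nu,
      rightPart (pairUp p.2.2 p.2.1) = p.2.1 ∧
      RowState σ lam nu c n b (pairUp p.2.2 p.2.1) ∧
      ColState τ lam nu b m c (pairUp p.2.2 p.2.1) := by
    intro p hp
    obtain ⟨⟨hmn, hlm, hms⟩, ⟨hTσ, hT⟩, hSτ, hS⟩ := (mem_tableauPairs hσf hτf p).1 hp
    have hr := rightPart_pairUp (disjoint_of_shapeOf hS hT)
    have hsh := shapeOf_pairUp hlm hmn hS hT
    have hinc : ∀ D : ℤ → ℤ → Prop, (∀ α β x y, p.2.2 α = some x → p.2.1 β = some y → ¬ D x y) →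
        CoverIncreasing D (pairUp p.2.2 p.2.1) := fun D =>
      coverIncreasing_pairUp hms hS hT (hτi _ hSτ).2 (hσi _ hTσ).2
    refine ⟨hr, ⟨hsh, ?_, hinc _ ?_, hr.symm ▸ hTσ⟩,
      ⟨hsh, ?_, hinc _ ?_, (leftPart_pairUp _ _).symm ▸ hSτ⟩⟩
    · intro α t ht
      rw [← rightPart_eq_some, hr] at ht
      have := hcd _ hTσ α t ht
      omega
    · intro α _ x _ hx _
      exact not_lt.2 (hab _ hSτ α x hx).2
    · intro α s hs
      rw [← leftPart_eq_some, leftPart_pairUp] at hs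
      have := hab _ hSτ α s hs
      omega
    · intro _ β _ y _ hy
      exact not_lt.2 (hcd _ hTσ β y hy).1
  refine Finset.card_le_card_of_injOn (fun p =>
    let U := switch b m c n (pairUp p.2.2 p.2.1)
    ⟨extendShape lam nu U (Sum.elim (fun _ => False) fun _ => True),
      leftPart U, rightPart U⟩) ?_ ?_
  · intro p hp
    obtain ⟨-, hrow, hcol⟩ := init p hp
    have hrow := hrow.switch (m := m) hσc hsk
    have hcol := hcol.switch (n := n) hτc hsk
    set U := switch b m c n (pairUp p.2.2 p.2.1)
    have hU := hrow.shape
    have hinc : CoverIncreasing (fun _ _ => True) U :=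
      hrow.increasing.congr fun α _ x _ hx _ => by simpa using (hcol.left_in α x hx).1
    have hlam : extendShape lam nu U (fun _ => False) = lam := by
      ext α
      simp [mem_extendShape hU]
    have hnu : extendShape lam nu U (fun _ => True) = nu := by
      ext α
      rw [mem_extendShape hU]
      constructor
      · rintro (h | ⟨v, hv, -⟩)
        · exact hsk.2.2 h
        · exact (mem_of_shapeOf hU hv).1
      · intro h
        by_cases hl : α ∈ lam
        · exact Or.inl hl
        · obtain ⟨v, hv⟩ := exists_of_shapeOf hU h hl
          exact Or.inr ⟨v, hv, trivial⟩
    rw [Finset.mem_coe, mem_tableauPairs]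
    refine ⟨⟨?_, Finset.subset_union_left, ?_⟩, ⟨hcol.left_mem, ?_⟩, hrow.right_mem, ?_⟩
    · exact Finset.union_subset hsk.2.2 (Finset.filter_subset _ _)
    · refine hinc.straightShape_extendShape hsk hU pairLT_trans_of_true ?_
      rintro (u | u) (v | v) <;> simp [pairLT]
    · have := shapeOf_part (P' := fun _ => True)
        (P := Sum.elim (fun _ => False) fun _ => True) Sum.inl hU (T := leftPart U)
        (fun _ _ => leftPart_eq_some) (by rintro (v | v) <;> simp)
      rwa [hnu] at this
    · have := shapeOf_part (P' := Sum.elim (fun _ => False) fun _ => True)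
        (P := fun _ => False) Sum.inr hU (T := rightPart U)
        (fun _ _ => rightPart_eq_some) (by rintro (v | v) <;> simp)
      rwa [hlam] at this
  · intro p hp q hq he
    simp only [Sigma.mk.injEq, heq_eq_eq, Prod.mk.injEq] at he
    obtain ⟨hpr, hprow, -⟩ := init p hp
    obtain ⟨hqr, hqrow, -⟩ := init q hq
    have hsw := (pairUp_parts _).symm.trans ((congrArg₂ pairUp he.2.1 he.2.2).trans
      (pairUp_parts _))
    have hU := hprow.switch_injective hσc hsk hqrow hsw
    have h1 : p.2.1 = q.2.1 := by rw [← hpr, hU, hqr]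
    have h2 : p.2.2 = q.2.2 := by
      rw [← leftPart_pairUp p.2.2 p.2.1, hU, leftPart_pairUp]
    obtain ⟨⟨-, hlp, -⟩, -, -, hSp⟩ := (mem_tableauPairs hσf hτf p).1 hp
    obtain ⟨⟨-, hlq, -⟩, -, -, hSq⟩ := (mem_tableauPairs hσf hτf q).1 hq
    have h3 : p.1 = q.1 := by
      rw [← Finset.coe_inj, ← Set.sdiff_union_of_subset (Finset.coe_subset.2 hlp), ← hSp, h2, hSq,
        Set.sdiff_union_of_subset (Finset.coe_subset.2 hlq)]
    exact Sigma.ext h3 (heq_of_eq (Prod.ext h1 h2))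

end Count

theorem slide_operators_commute {L : Type} [PartialOrder L]
    (hmin : {x : L | ∀ y : L, ¬ y < x}.Finite)
    (hcov : ∀ x : L, {y : L | x ⋖ y}.Finite)
    (σ τ : Set (L → Option ℤ))
    (hσi : ∀ T ∈ σ, IncreasingSkewTableau T) (hτi : ∀ T ∈ τ, IncreasingSkewTableau T)
    (hσf : LocallyFiniteSet σ) (hτf : LocallyFiniteSet τ)
    (hσc : JdtClosed σ) (hτc : JdtClosed τ)
    (lam nu : Finset L) (hl : StraightShape lam) (hn : StraightShape nu) (hln : lam ⊆ nu) :
    ∑ mu ∈ nu.powerset.filter (fun m => lam ⊆ m ∧ StraightShape m),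
        tcount σ mu nu * tcount τ lam mu
      = ∑ mu ∈ nu.powerset.filter (fun m => lam ⊆ m ∧ StraightShape m),
        tcount τ mu nu * tcount σ lam mu := by
  exact le_antisymm (sum_tcount_le hσi hτi hσf hτf hσc hτc ⟨hl, hn, hln⟩)
    (sum_tcount_le hτi hσi hτf hσf hτc hσc ⟨hl, hn, hln⟩)
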